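/- Under the mechanism E, the absolute-error distortion of the proper companion estimator q̂_φ satisfies: for every database x ∈ D^n, E_{Y∼E(x)}[|q̂_φ(Y) − q_φ(x)|] ≤ 2(b−a)(1+(2^l−1)e^{−ε}) / (c(1−e^{−ε})·√n). -/

import Mathlib

open Finset

abbrev Row (l : ℕ) := Fin l → Bool
abbrev Db (l n : ℕ) := Fin n → Row l

/-- Hamming distance on `D^n`. -/
def ham {l n : ℕ} (x y : Db l n) : ℕ :=
  (Finset.univ.filter fun i => x i ≠ y i).card

/-- The pmf of the mechanism `E` on input `x`. -/
noncomputable def pE (l : ℕ) (ε : ℝ) {n : ℕ} (x y : Db l n) : ℝ :=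
  Real.exp (-ε * (ham x y : ℝ)) / (1 + ((2:ℝ) ^ l - 1) * Real.exp (-ε)) ^ n

/-- `a_i = min_{v ∈ D} φ_i(v)`. -/
noncomputable def Amin {l n : ℕ} (φ : Fin n → Row l → ℝ) (i : Fin n) : ℝ :=
  Finset.univ.inf' Finset.univ_nonempty (φ i)

/-- `b_i = max_{v ∈ D} φ_i(v)`. -/
noncomputable def Bmax {l n : ℕ} (φ : Fin n → Row l → ℝ) (i : Fin n) : ℝ :=
  Finset.univ.sup' Finset.univ_nonempty (φ i)

/-- The statistical query `q_φ(x) = (∑ i φ_i(x_i)) / (∑ i c_i)` with `c_i = b_i - a_i`. -/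
noncomputable def qS {l n : ℕ} (φ : Fin n → Row l → ℝ) (x : Db l n) : ℝ :=
  (∑ i, φ i (x i)) / (∑ i, (Bmax φ i - Amin φ i))

/-- `C_φ = (∑ i ∑ v φ_i(v)) / (∑ i c_i)`. -/
noncomputable def Cphi {l n : ℕ} (φ : Fin n → Row l → ℝ) : ℝ :=
  (∑ i, ∑ v : Row l, φ i v) / (∑ i, (Bmax φ i - Amin φ i))

/-- The unbiased companion estimator
`q̂ᵘ_φ(y) = (g(ε)/(1-e^{-ε})) q_φ(y) - (e^{-ε}/(1-e^{-ε})) C_φ` where `g(ε)=1+(2^l-1)e^{-ε}`. -/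
noncomputable def qhatu {l n : ℕ} (ε : ℝ) (φ : Fin n → Row l → ℝ) (y : Db l n) : ℝ :=
  ((1 + ((2:ℝ) ^ l - 1) * Real.exp (-ε)) / (1 - Real.exp (-ε))) * qS φ y
    - (Real.exp (-ε) / (1 - Real.exp (-ε))) * Cphi φ

/-- The pmf of the mechanism on a single row. -/
noncomputable def rowPMF (l : ℕ) (ε : ℝ) (u v : Row l) : ℝ :=
  (if v = u then 1 else Real.exp (-ε)) / (1 + ((2:ℝ) ^ l - 1) * Real.exp (-ε))

lemma normalizer_pos (l : ℕ) (ε : ℝ) : 0 < 1 + ((2:ℝ) ^ l - 1) * Real.exp (-ε) := by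
  have h1 : (1:ℝ) ≤ 2 ^ l := one_le_pow₀ (by norm_num)
  have h2 := mul_nonneg (sub_nonneg.2 h1) (Real.exp_pos (-ε)).le
  linarith

lemma rowPMF_nonneg (l : ℕ) (ε : ℝ) (u v : Row l) : 0 ≤ rowPMF l ε u v := by
  unfold rowPMF
  refine div_nonneg ?_ (normalizer_pos l ε).le
  split_ifs
  · exact zero_le_one
  · exact (Real.exp_pos _).le

lemma sum_rowPMF_mul (l : ℕ) (ε : ℝ) (u : Row l) (f : Row l → ℝ) :
    ∑ v, rowPMF l ε u v * f v =
      ((1 - Real.exp (-ε)) * f u + Real.exp (-ε) * ∑ v, f v) /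
        (1 + ((2:ℝ) ^ l - 1) * Real.exp (-ε)) := by
  have h (v : Row l) : rowPMF l ε u v * f v =
      ((if v = u then (1 - Real.exp (-ε)) * f v else 0) + Real.exp (-ε) * f v) /
        (1 + ((2:ℝ) ^ l - 1) * Real.exp (-ε)) := by
    unfold rowPMF
    split_ifs <;> ring
  simp_rw [h]
  rw [← Finset.sum_div, Finset.sum_add_distrib, ← Finset.mul_sum]
  simp

lemma sum_rowPMF (l : ℕ) (ε : ℝ) (u : Row l) : ∑ v, rowPMF l ε u v = 1 := by
  have h := sum_rowPMF_mul l ε u fun _ => 1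
  simp only [mul_one] at h
  rw [h, div_eq_one_iff_eq (normalizer_pos l ε).ne']
  simp
  ring

lemma pE_eq_prod (l : ℕ) (ε : ℝ) {n : ℕ} (x y : Db l n) :
    pE l ε x y = ∏ i, rowPMF l ε (x i) (y i) := by
  unfold pE rowPMF
  rw [Finset.prod_div_distrib, Finset.prod_const, Finset.card_univ, Fintype.card_fin]
  congr 1
  rw [Finset.prod_ite, Finset.prod_const_one, one_mul, Finset.prod_const, ham, mul_comm,
    Real.exp_nat_mul]
  simp only [ne_eq, eq_comm]

section ProductWeights

variable {ι α : Type*} [Fintype ι] [DecidableEq ι] [Fintype α]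

lemma sum_prod_weights (r : ι → α → ℝ) (hr : ∀ i, ∑ v, r i v = 1) :
    ∑ y : ι → α, ∏ i, r i (y i) = 1 := by
  rw [← Fintype.prod_sum]
  simp [hr]

lemma sum_prod_weights_mul_mul_eq_zero (r h : ι → α → ℝ) (hh : ∀ i, ∑ v, r i v * h i v = 0)
    {i j : ι} (hij : i ≠ j) :
    ∑ y : ι → α, (∏ k, r k (y k)) * (h i (y i) * h j (y j)) = 0 := by
  have key (y : ι → α) : (∏ k, r k (y k)) * (h i (y i) * h j (y j)) =
      ∏ k, (r k (y k) * ((if k = i then h k (y k) else 1) *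
        (if k = j then h k (y k) else 1))) := by
    rw [Finset.prod_mul_distrib, Finset.prod_mul_distrib]
    simp
  simp_rw [key]
  rw [← Fintype.prod_sum fun k v =>
    r k v * ((if k = i then h k v else 1) * (if k = j then h k v else 1))]
  apply Finset.prod_eq_zero (Finset.mem_univ i)
  simp [hij, hh]

/-- The second moment of a sum of independent, centred variables bounded by `B`. -/
lemma sum_prod_weights_mul_sq_le (r h : ι → α → ℝ) (hr0 : ∀ i v, 0 ≤ r i v)
    (hr : ∀ i, ∑ v, r i v = 1) (hh : ∀ i, ∑ v, r i v * h i v = 0) (B : ℝ)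
    (hB : ∀ i v, |h i v| ≤ B) :
    ∑ y : ι → α, (∏ k, r k (y k)) * (∑ i, h i (y i)) ^ 2 ≤ Fintype.card ι * B ^ 2 := by
  have hexp (y : ι → α) : (∏ k, r k (y k)) * (∑ i, h i (y i)) ^ 2 =
      ∑ i, ∑ j, (∏ k, r k (y k)) * (h i (y i) * h j (y j)) := by
    rw [sq, Finset.sum_mul_sum, Finset.mul_sum]
    simp_rw [Finset.mul_sum]
  simp_rw [hexp]
  rw [Finset.sum_comm]
  have hi (i : ι) :
      ∑ y : ι → α, ∑ j, (∏ k, r k (y k)) * (h i (y i) * h j (y j)) ≤ B ^ 2 := by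
    rw [Finset.sum_comm, Finset.sum_eq_single i
      (fun j _ hj => sum_prod_weights_mul_mul_eq_zero r h hh hj.symm) (by simp)]
    calc _ ≤ ∑ y : ι → α, (∏ k, r k (y k)) * B ^ 2 := by
          refine Finset.sum_le_sum fun y _ => ?_
          refine mul_le_mul_of_nonneg_left ?_ (Finset.prod_nonneg fun k _ => hr0 k _)
          rw [← sq]
          exact sq_le_sq' (abs_le.1 (hB i _)).1 (abs_le.1 (hB i _)).2
      _ = B ^ 2 := by rw [← Finset.sum_mul, sum_prod_weights r hr, one_mul]
  calc _ ≤ ∑ _i : ι, B ^ 2 := Finset.sum_le_sum fun i _ => hi i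
    _ = _ := by simp

lemma sum_prod_weights_mul_abs_le (r h : ι → α → ℝ) (hr0 : ∀ i v, 0 ≤ r i v)
    (hr : ∀ i, ∑ v, r i v = 1) (hh : ∀ i, ∑ v, r i v * h i v = 0) (B : ℝ) (hB0 : 0 ≤ B)
    (hB : ∀ i v, |h i v| ≤ B) :
    ∑ y : ι → α, (∏ k, r k (y k)) * |∑ i, h i (y i)| ≤ Real.sqrt (Fintype.card ι) * B := by
  have hp (y : ι → α) : 0 ≤ ∏ k, r k (y k) := Finset.prod_nonneg fun k _ => hr0 k _
  have hcs := Finset.sum_sq_le_sum_mul_sum_of_sq_le_mul Finset.univ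
    (r := fun y : ι → α => (∏ k, r k (y k)) * |∑ i, h i (y i)|)
    (f := fun y : ι → α => ∏ k, r k (y k))
    (g := fun y : ι → α => (∏ k, r k (y k)) * (∑ i, h i (y i)) ^ 2)
    (fun y _ => hp y) (fun y _ => mul_nonneg (hp y) (sq_nonneg _))
    (fun y _ => by rw [mul_pow, sq_abs, sq, mul_assoc])
  rw [sum_prod_weights r hr, one_mul] at hcs
  refine abs_le_of_sq_le_sq' ?_ (by positivity) |>.2
  rw [mul_pow, Real.sq_sqrt (Nat.cast_nonneg _)]
  exact hcs.trans (sum_prod_weights_mul_sq_le r h hr0 hr hh B hB)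

end ProductWeights

/-- The estimation error of the unbiased estimator is a rescaled sum of centred row terms. -/
lemma qhatu_sub_qS {l n : ℕ} {ε : ℝ} (hε : 0 < ε) (φ : Fin n → Row l → ℝ) (x y : Db l n) :
    qhatu ε φ y - qS φ x =
      (1 + ((2:ℝ) ^ l - 1) * Real.exp (-ε)) /
        ((1 - Real.exp (-ε)) * ∑ i, (Bmax φ i - Amin φ i)) *
        ∑ i, (φ i (y i) - ∑ v, rowPMF l ε (x i) v * φ i v) := by
  have he : Real.exp (-ε) < 1 := by simpa using hε
  have he' : 1 - Real.exp (-ε) ≠ 0 := by linarith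
  have hg := (normalizer_pos l ε).ne'
  unfold qhatu qS Cphi
  generalize (∑ i, (Bmax φ i - Amin φ i)) = S
  simp_rw [sum_rowPMF_mul]
  rw [Finset.sum_sub_distrib, ← Finset.sum_div, Finset.sum_add_distrib, ← Finset.mul_sum,
    ← Finset.mul_sum]
  generalize 1 + ((2:ℝ) ^ l - 1) * Real.exp (-ε) = g at *
  rcases eq_or_ne S 0 with rfl | hS
  · simp
  · field_simp
    ring

lemma abs_sub_weighted_mean_le {α : Type*} [Fintype α] (r f : α → ℝ) (hr0 : ∀ v, 0 ≤ r v)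
    (hr : ∑ v, r v = 1) {a b : ℝ} (hf : ∀ v, f v ∈ Set.Icc a b) (u : α) :
    |f u - ∑ v, r v * f v| ≤ b - a := by
  have hlo : a ≤ ∑ v, r v * f v := by
    calc a = ∑ v, r v * a := by rw [← Finset.sum_mul, hr, one_mul]
      _ ≤ _ := Finset.sum_le_sum fun v _ => mul_le_mul_of_nonneg_left (hf v).1 (hr0 v)
  have hhi : ∑ v, r v * f v ≤ b := by
    calc _ ≤ ∑ v, r v * b :=
          Finset.sum_le_sum fun v _ => mul_le_mul_of_nonneg_left (hf v).2 (hr0 v)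
      _ = b := by rw [← Finset.sum_mul, hr, one_mul]
  have h := hf u
  exact abs_le.2 ⟨by linarith [h.1], by linarith [h.2]⟩

/-- Under the mechanism `E`, the absolute-error distortion of the proper companion estimator
`q̂_φ` satisfies `E_{Y∼E(x)}[|q̂_φ(Y) - q_φ(x)|] ≤ 2(b-a)(1+(2^l-1)e^{-ε})/(c(1-e^{-ε})√n)`. -/
theorem stmt7 (l n : ℕ) (hl : 1 ≤ l) (hn : 1 ≤ n) (ε : ℝ) (hε : 0 < ε)
    (φ : Fin n → Row l → ℝ) (a b c : ℝ) (hc : 0 < c)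
    (hq : ∀ i, a ≤ Amin φ i ∧ Amin φ i < Bmax φ i ∧ Bmax φ i ≤ b ∧
      c ≤ Bmax φ i - Amin φ i)
    (qhat : Db l n → ℝ)
    (hproper : ∀ y : Db l n, ∃ x0 : Db l n, qhat y = qS φ x0)
    (hmin : ∀ (y : Db l n) (x0 : Db l n), |qhatu ε φ y - qhat y| ≤ |qhatu ε φ y - qS φ x0|)
    (x : Db l n) :
    (∑ y : Db l n, pE l ε x y * |qhat y - qS φ x|)
      ≤ 2 * (b - a) * (1 + ((2:ℝ) ^ l - 1) * Real.exp (-ε))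
          / (c * (1 - Real.exp (-ε)) * Real.sqrt n) := by
  have hn0 : (0:ℝ) < n := by exact_mod_cast hn
  have he : 0 < 1 - Real.exp (-ε) := by simpa using hε
  have hg := normalizer_pos l ε
  have hmem (i : Fin n) (v : Row l) : φ i v ∈ Set.Icc a b :=
    ⟨(hq i).1.trans (Finset.inf'_le _ (Finset.mem_univ v)),
      (Finset.le_sup' (φ i) (Finset.mem_univ v)).trans (hq i).2.2.1⟩
  have hab : 0 ≤ b - a := by
    have h := hq ⟨0, hn⟩
    linarith [h.1, h.2.1, h.2.2.1]
  have hS : n * c ≤ ∑ i, (Bmax φ i - Amin φ i) := by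
    calc (n:ℝ) * c = ∑ _i : Fin n, c := by simp
      _ ≤ _ := Finset.sum_le_sum fun i _ => (hq i).2.2.2
  have hS0 : 0 < ∑ i, (Bmax φ i - Amin φ i) := (mul_pos hn0 hc).trans_le hS
  have herr (y : Db l n) : |qhat y - qS φ x| ≤ 2 * |qhatu ε φ y - qS φ x| := by
    have h := abs_sub_le (qhat y) (qhatu ε φ y) (qS φ x)
    rw [abs_sub_comm (qhat y) (qhatu ε φ y)] at h
    linarith [hmin y x]
  have hmom := sum_prod_weights_mul_abs_le (fun i => rowPMF l ε (x i))
    (fun i v => φ i v - ∑ w, rowPMF l ε (x i) w * φ i w)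
    (fun i => rowPMF_nonneg l ε (x i)) (fun i => sum_rowPMF l ε (x i))
    (fun i => by
      simp_rw [mul_sub]
      rw [Finset.sum_sub_distrib, ← Finset.sum_mul, sum_rowPMF, one_mul, sub_self])
    (b - a) hab
    (fun i => abs_sub_weighted_mean_le _ (φ i) (rowPMF_nonneg l ε (x i))
      (sum_rowPMF l ε (x i)) (hmem i))
  rw [Fintype.card_fin] at hmom
  set G := 1 + ((2:ℝ) ^ l - 1) * Real.exp (-ε) with hG
  set S := ∑ i, (Bmax φ i - Amin φ i) with hSdef
  have hK : 0 < G / ((1 - Real.exp (-ε)) * S) := by positivity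
  calc ∑ y : Db l n, pE l ε x y * |qhat y - qS φ x|
      ≤ ∑ y : Db l n, 2 * (G / ((1 - Real.exp (-ε)) * S)) *
          ((∏ i, rowPMF l ε (x i) (y i)) *
            |∑ i, (φ i (y i) - ∑ v, rowPMF l ε (x i) v * φ i v)|) := by
        refine Finset.sum_le_sum fun y _ => ?_
        have h := herr y
        rw [qhatu_sub_qS hε, abs_mul, abs_of_pos hK] at h
        rw [pE_eq_prod]
        refine (mul_le_mul_of_nonneg_left h
          (Finset.prod_nonneg fun i _ => rowPMF_nonneg l ε _ _)).trans_eq ?_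
        ring
    _ ≤ 2 * (G / ((1 - Real.exp (-ε)) * S)) * (Real.sqrt n * (b - a)) := by
        rw [← Finset.mul_sum]
        exact mul_le_mul_of_nonneg_left hmom (by positivity)
    _ ≤ 2 * (G / ((1 - Real.exp (-ε)) * (n * c))) * (Real.sqrt n * (b - a)) := by
        gcongr
    _ = 2 * (b - a) * G / (c * (1 - Real.exp (-ε)) * Real.sqrt n) := by
        have hs : 0 < Real.sqrt n := Real.sqrt_pos.2 hn0
        have hsq : (n:ℝ) = Real.sqrt n * Real.sqrt n := (Real.mul_self_sqrt hn0.le).symm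
        generalize Real.sqrt n = s at *
        rw [hsq]
        field_simp
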